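/- For every a ∈ [0, ā], there exists d ∈ [0, M] such that g_a(d) = 0, where g_a(y) = (1+η)𝔼[(X − y)⁺ − (X − y − (S+a)⁺)⁺] − a. -/

import Mathlib

open MeasureTheory Set

noncomputable section

variable {Ω : Type*} [MeasurableSpace Ω]
/-- Full-insurance premium `π_f = (1+η)𝔼[X]`. -/
def piFull (ℙ : Measure Ω) (η : ℝ) (X : Ω → ℝ) : ℝ := (1 + η) * ∫ ω, X ω ∂ℙ

/-- `g(a) = (1+η)·𝔼[X − (X − (S+a)⁺)⁺] − a`. -/
def gfun (ℙ : Measure Ω) (η : ℝ) (X S : Ω → ℝ) (a : ℝ) : ℝ :=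
  (1 + η) * ∫ ω, (X ω - max (X ω - max (S ω + a) 0) 0) ∂ℙ - a

/-- `ā = inf {a ∈ [0, π_f] : g(a) ≤ 0}`. -/
def abar (ℙ : Measure Ω) (η : ℝ) (X S : Ω → ℝ) : ℝ :=
  sInf {a | a ∈ Icc 0 (piFull ℙ η X) ∧ gfun ℙ η X S a ≤ 0}

/-- `g_a(y) = (1+η)·𝔼[(X − y)⁺ − (X − y − (S+a)⁺)⁺] − a`. -/
def gposA (ℙ : Measure Ω) (η : ℝ) (X S : Ω → ℝ) (a y : ℝ) : ℝ :=
  (1 + η) * ∫ ω, (max (X ω - y) 0 - max (X ω - y - max (S ω + a) 0) 0) ∂ℙ - a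

/-- A nonzero real essential supremum is an almost everywhere upper bound: for a function which is
not essentially bounded above, the real-valued `essSup` is `0`. -/
lemma ae_le_of_essSup_eq_of_ne_zero {μ : Measure Ω} {X : Ω → ℝ} {M : ℝ}
    (hM : essSup X μ = M) (hM0 : M ≠ 0) : ∀ᵐ ω ∂μ, X ω ≤ M := by
  have hbdd : Filter.IsBoundedUnder (· ≤ ·) (ae μ) X := by
    by_contra h
    refine hM0 (hM ▸ ?_)
    rw [essSup, Filter.limsup_eq]
    have : {a : ℝ | ∀ᵐ ω ∂μ, X ω ≤ a} = ∅ :=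
      eq_empty_of_forall_notMem fun a ha => h ⟨a, Filter.eventually_map.2 ha⟩
    rw [this, Real.sInf_empty]
  exact hM ▸ ae_le_essSup hbdd

lemma sub_max_sub_nonneg {x t : ℝ} (hx : 0 ≤ x) (ht : 0 ≤ t) : 0 ≤ x - max (x - t) 0 := by
  rw [sub_nonneg]
  exact max_le (by linarith) hx

lemma sub_max_sub_le (x t : ℝ) : x - max (x - t) 0 ≤ x :=
  sub_le_self _ (le_max_right _ _)

lemma max_sub_max_sub_eq (z : ℝ) {t : ℝ} (ht : 0 ≤ t) :
    max z 0 - max (z - t) 0 = max z 0 - max (max z 0 - t) 0 := by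
  rcases le_total z 0 with hz | hz
  · simp [max_eq_right hz, max_eq_right (by linarith : z - t ≤ 0), ht]
  · rw [max_eq_left hz]

lemma continuous_gfun {ℙ : Measure Ω} {η : ℝ} {X S : Ω → ℝ} (hXm : Measurable X)
    (hSm : Measurable S) (hX0 : ∀ ω, 0 ≤ X ω) (hXi : Integrable X ℙ) :
    Continuous (gfun ℙ η X S) := by
  refine (continuous_const.mul ?_).sub continuous_id
  refine continuous_of_dominated (bound := X) (fun a => ?_) (fun a => ?_) hXi ?_
  · exact Measurable.aestronglyMeasurable (by fun_prop)
  · refine .of_forall fun ω => ?_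
    rw [Real.norm_of_nonneg (sub_max_sub_nonneg (hX0 ω) (le_max_right _ _))]
    exact sub_max_sub_le _ _
  · exact .of_forall fun ω => by fun_prop

lemma continuousOn_gposA {ℙ : Measure Ω} {η : ℝ} {X S : Ω → ℝ} (hXm : Measurable X)
    (hSm : Measurable S) (hX0 : ∀ ω, 0 ≤ X ω) (hXi : Integrable X ℙ) (a : ℝ) :
    ContinuousOn (gposA ℙ η X S a) (Ici 0) := by
  refine (continuousOn_const.mul ?_).sub continuousOn_const
  refine continuousOn_of_dominated (bound := X) (fun y _ => ?_) (fun y hy => ?_) hXi ?_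
  · exact Measurable.aestronglyMeasurable (by fun_prop)
  · refine .of_forall fun ω => ?_
    have ht : 0 ≤ max (S ω + a) 0 := le_max_right _ _
    rw [max_sub_max_sub_eq _ ht, Real.norm_of_nonneg (sub_max_sub_nonneg (le_max_right _ _) ht)]
    exact (sub_max_sub_le _ _).trans (max_le (sub_le_self _ hy) (hX0 ω))
  · exact .of_forall fun ω => by fun_prop

lemma gposA_zero {ℙ : Measure Ω} {η : ℝ} {X S : Ω → ℝ} (hX0 : ∀ ω, 0 ≤ X ω) (a : ℝ) :
    gposA ℙ η X S a 0 = gfun ℙ η X S a := by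
  simp [gposA, gfun, hX0]

lemma gposA_of_ae_le {ℙ : Measure Ω} {η : ℝ} {X S : Ω → ℝ} {M : ℝ}
    (hXM : ∀ᵐ ω ∂ℙ, X ω ≤ M) (a : ℝ) : gposA ℙ η X S a M = -a := by
  have h : ∫ ω, (max (X ω - M) 0 - max (X ω - M - max (S ω + a) 0) 0) ∂ℙ = 0 := by
    refine integral_eq_zero_of_ae ?_
    filter_upwards [hXM] with ω hω
    have ht : 0 ≤ max (S ω + a) 0 := le_max_right _ _
    rw [max_eq_right (by linarith), max_eq_right (by linarith), sub_zero, Pi.zero_apply]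
  rw [gposA, h, mul_zero, zero_sub]

lemma gfun_zero_nonneg {ℙ : Measure Ω} {η : ℝ} {X S : Ω → ℝ} (hX0 : ∀ ω, 0 ≤ X ω)
    (hη : 0 ≤ η) : 0 ≤ gfun ℙ η X S 0 := by
  rw [gfun, sub_zero]
  exact mul_nonneg (by linarith)
    (integral_nonneg fun ω => sub_max_sub_nonneg (hX0 ω) (le_max_right _ _))

lemma gfun_piFull_nonpos {ℙ : Measure Ω} {η : ℝ} {X S : Ω → ℝ} (hX0 : ∀ ω, 0 ≤ X ω)
    (hXi : Integrable X ℙ) (hη : 0 ≤ η) : gfun ℙ η X S (piFull ℙ η X) ≤ 0 := by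
  rw [gfun, sub_nonpos]
  refine mul_le_mul_of_nonneg_left ?_ (by linarith)
  exact integral_mono_of_nonneg
    (.of_forall fun ω => sub_max_sub_nonneg (hX0 ω) (le_max_right _ _)) hXi
    (.of_forall fun ω => sub_max_sub_le _ _)

lemma gfun_nonneg_of_mem_Icc_abar {ℙ : Measure Ω} {η : ℝ} {X S : Ω → ℝ} (hXm : Measurable X)
    (hSm : Measurable S) (hX0 : ∀ ω, 0 ≤ X ω) (hXi : Integrable X ℙ) (hη : 0 ≤ η) {a : ℝ}
    (ha : a ∈ Icc 0 (abar ℙ η X S)) : 0 ≤ gfun ℙ η X S a := by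
  have hπ : 0 ≤ piFull ℙ η X := mul_nonneg (by linarith) (integral_nonneg hX0)
  have hbdd : BddBelow {a | a ∈ Icc 0 (piFull ℙ η X) ∧ gfun ℙ η X S a ≤ 0} :=
    ⟨0, fun b hb => hb.1.1⟩
  have hle : abar ℙ η X S ≤ piFull ℙ η X :=
    csInf_le hbdd ⟨⟨hπ, le_rfl⟩, gfun_piFull_nonpos hX0 hXi hη⟩
  have hlt : Ico 0 (abar ℙ η X S) ⊆ {b | 0 ≤ gfun ℙ η X S b} := fun b hb => by
    by_contra hneg
    exact hb.2.not_ge (csInf_le hbdd ⟨⟨hb.1, hb.2.le.trans hle⟩, (not_le.1 hneg).le⟩)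
  rcases (ha.1.trans ha.2).eq_or_lt with h0 | hpos
  · obtain rfl : a = 0 := le_antisymm (h0 ▸ ha.2) ha.1
    exact gfun_zero_nonneg hX0 hη
  · have hclosed : IsClosed {b | 0 ≤ gfun ℙ η X S b} :=
      isClosed_le continuous_const (continuous_gfun hXm hSm hX0 hXi)
    have hsub := closure_minimal hlt hclosed
    rw [closure_Ico hpos.ne] at hsub
    exact hsub ha

/-- for every `a ∈ [0, ā]` there exists `d ∈ [0, M]` with `g_a(d) = 0`. -/
theorem stmt6
    (ℙ : Measure Ω) [IsProbabilityMeasure ℙ]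
    (X S : Ω → ℝ) (hXm : Measurable X) (hSm : Measurable S)
    (hX0 : ∀ ω, 0 ≤ X ω) (M : ℝ) (hM : essSup X ℙ = M) (hM0 : 0 < M)
    (η : ℝ) (hη : 0 ≤ η) :
    ∀ a ∈ Icc 0 (abar ℙ η X S), ∃ d ∈ Icc (0 : ℝ) M, gposA ℙ η X S a d = 0 := by
  intro a ha
  have hXM : ∀ᵐ ω ∂ℙ, X ω ≤ M := ae_le_of_essSup_eq_of_ne_zero hM hM0.ne'
  have hXi : Integrable X ℙ := by
    refine .of_bound hXm.aestronglyMeasurable M ?_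
    filter_upwards [hXM] with ω hω
    rwa [Real.norm_of_nonneg (hX0 ω)]
  refine intermediate_value_Icc' hM0.le
    ((continuousOn_gposA hXm hSm hX0 hXi a).mono Icc_subset_Ici_self) ⟨?_, ?_⟩
  · rw [gposA_of_ae_le hXM]
    linarith [ha.1]
  · rw [gposA_zero hX0]
    exact gfun_nonneg_of_mem_Icc_abar hXm hSm hX0 hXi hη ha
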